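/- arXiv:2207.03438 — 2 statements merged into one kernel-verified Lean document; each statement's English description precedes it below -/
import Mathlib

section
/- For any x > 0, the value function satisfies v(x) = inf_{α ∈ ℬ} J(x,α), where ℬ := {α ∈ 𝒜 : there exists t_0 ≥ 0 such that α(t) = M(t)·1_{[0,t_0]}(t) + m(t)·1_{(t_0,T]}(t) for almost every t ∈ [0,T]}. -/
open MeasureTheory Set

noncomputable section

/-- Admissible repayment strategies: measurable, with `m t ≤ α t ≤ M t` on `[0,T]`. -/
def Adm (T : ℝ) (m M : ℝ → ℝ) : Set (ℝ → ℝ) :=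
  {α | Measurable α ∧ ∀ t ∈ Icc (0:ℝ) T, m t ≤ α t ∧ α t ≤ M t}

/-- Compound-interest balance. -/
def balC (r β x : ℝ) (α : ℝ → ℝ) (t : ℝ) : ℝ :=
  Real.exp ((r + β) * t) * (x - ∫ s in (0:ℝ)..t, Real.exp (-(r + β) * s) * α s)

/-- Terminal time: first zero of the balance in `[0,T]`, capped at `T`. -/
def tauC (r β T x : ℝ) (α : ℝ → ℝ) : ℝ :=
  sInf (insert T {t | t ∈ Icc (0:ℝ) T ∧ balC r β x α t = 0})

/-- Repayment cost. -/
def costC (r β T ω x : ℝ) (α : ℝ → ℝ) : ℝ :=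
  (∫ t in (0:ℝ)..(tauC r β T x α), Real.exp (-r * t) * α t)
    + ω * Real.exp (-r * tauC r β T x α) * balC r β x α (tauC r β T x α)

/-- Value function. -/
def valC (r β T ω : ℝ) (m M : ℝ → ℝ) (x : ℝ) : ℝ :=
  sInf (costC r β T ω x '' Adm T m M)

/-- Critical horizon `t_c = max(T + log ω / β, 0)`. -/
def tCrit (β T ω : ℝ) : ℝ := max (T + Real.log ω / β) 0

/-- The cost `v₁` of the max-min strategy. -/
def vOne (r β T ω : ℝ) (m M : ℝ → ℝ) (x : ℝ) : ℝ :=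
  (∫ s in (0:ℝ)..(tCrit β T ω), Real.exp (-r * s) * M s)
  + (∫ s in (tCrit β T ω)..T, Real.exp (-r * s) * m s)
  + ω * Real.exp (β * T) *
    (x - (∫ s in (0:ℝ)..(tCrit β T ω), Real.exp (-(r + β) * s) * M s)
       - ∫ s in (tCrit β T ω)..T, Real.exp (-(r + β) * s) * m s)

/-- `x̂ = ∫_0^{t_c} e^{-(r+β)s} M(s) ds`. -/
def xHat (r β T ω : ℝ) (M : ℝ → ℝ) : ℝ :=
  ∫ s in (0:ℝ)..(tCrit β T ω), Real.exp (-(r + β) * s) * M s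

/-- `x̄ = ∫_0^T e^{-(r+β)s} M(s) ds`. -/
def xBar (r β T : ℝ) (M : ℝ → ℝ) : ℝ :=
  ∫ s in (0:ℝ)..T, Real.exp (-(r + β) * s) * M s

/-- `x̲ = ∫_0^T e^{-(r+β)s} m(s) ds`. -/
def xLow (r β T : ℝ) (m : ℝ → ℝ) : ℝ :=
  ∫ s in (0:ℝ)..T, Real.exp (-(r + β) * s) * m s

/-- `x_c = ∫_0^{t_c} e^{-(r+β)s} M(s) ds + ∫_{t_c}^T e^{-(r+β)s} m(s) ds`. -/
def xCrit (r β T ω : ℝ) (m M : ℝ → ℝ) : ℝ :=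
  xHat r β T ω M + ∫ s in (tCrit β T ω)..T, Real.exp (-(r + β) * s) * m s

/-- The max-min strategy that switches from `M` to `m` at time `t0`. -/
def maxMin (m M : ℝ → ℝ) (t0 t : ℝ) : ℝ := if t ≤ t0 then M t else m t

lemma maxMin_mem_Adm {T : ℝ} {m M : ℝ → ℝ} (hm : Measurable m) (hM : Measurable M)
    (hmM : ∀ t ∈ Icc (0:ℝ) T, m t ≤ M t) (t0 : ℝ) : maxMin m M t0 ∈ Adm T m M := by
  refine ⟨Measurable.ite measurableSet_Iic hM hm, fun t ht => ?_⟩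
  have h := hmM t ht
  unfold maxMin
  split_ifs
  · exact ⟨h, le_rfl⟩
  · exact ⟨le_rfl, h⟩

lemma integrableOn_of_mem_Adm {T : ℝ} {m M α : ℝ → ℝ}
    (hm : IntegrableOn m (Icc (0:ℝ) T)) (hM : IntegrableOn M (Icc (0:ℝ) T))
    (hα : α ∈ Adm T m M) : IntegrableOn α (Icc (0:ℝ) T) := by
  refine Integrable.mono' (hm.abs.add hM.abs) hα.1.aestronglyMeasurable ?_
  refine (ae_restrict_iff' measurableSet_Icc).2 (ae_of_all _ fun t ht => ?_)
  obtain ⟨h1, h2⟩ := hα.2 t ht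
  simp only [Pi.add_apply, Real.norm_eq_abs]
  refine abs_le.2 ⟨?_, ?_⟩
  · linarith [neg_abs_le (m t), abs_nonneg (M t)]
  · linarith [le_abs_self (M t), abs_nonneg (m t)]

lemma integrableOn_exp_mul {T : ℝ} {f : ℝ → ℝ} (hf : IntegrableOn f (Icc (0:ℝ) T)) (c : ℝ) :
    IntegrableOn (fun t => Real.exp (c * t) * f t) (Icc (0:ℝ) T) :=
  hf.continuousOn_mul (by fun_prop) isCompact_Icc

lemma intervalIntegrable_of_integrableOn_Icc {T a b : ℝ} {f : ℝ → ℝ}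
    (hf : IntegrableOn f (Icc (0:ℝ) T)) (ha : a ∈ Icc (0:ℝ) T) (hb : b ∈ Icc (0:ℝ) T) :
    IntervalIntegrable f volume a b :=
  (hf.mono_set (Set.uIcc_subset_Icc ha hb)).intervalIntegrable

lemma continuousOn_primitive_of_integrableOn_Icc {T : ℝ} {f : ℝ → ℝ} (hT : 0 ≤ T)
    (hf : IntegrableOn f (Icc (0:ℝ) T)) :
    ContinuousOn (fun t => ∫ s in (0:ℝ)..t, f s) (Icc (0:ℝ) T) := by
  have h := intervalIntegral.continuousOn_primitive_interval (μ := volume) (f := f)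
    (a := 0) (b := T) (by rwa [uIcc_of_le hT])
  rwa [uIcc_of_le hT] at h

lemma balC_eq_zero_iff {r β x : ℝ} {α : ℝ → ℝ} {t : ℝ} :
    balC r β x α t = 0 ↔ (∫ s in (0:ℝ)..t, Real.exp (-(r + β) * s) * α s) = x := by
  rw [balC, mul_eq_zero, sub_eq_zero, eq_comm (a := x)]
  simp [Real.exp_ne_zero]

lemma isLeast_tauC {r β T x : ℝ} {α : ℝ → ℝ} (hT : 0 ≤ T)
    (hα : IntegrableOn α (Icc (0:ℝ) T)) :
    IsLeast (insert T {t | t ∈ Icc (0:ℝ) T ∧ balC r β x α t = 0}) (tauC r β T x α) := by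
  have hc : ContinuousOn (balC r β x α) (Icc (0:ℝ) T) := by
    unfold balC
    exact ContinuousOn.mul (by fun_prop) (continuousOn_const.sub
      (continuousOn_primitive_of_integrableOn_Icc hT (integrableOn_exp_mul hα _)))
  have hcl : IsClosed {t | t ∈ Icc (0:ℝ) T ∧ balC r β x α t = 0} :=
    hc.preimage_isClosed_of_isClosed isClosed_Icc isClosed_singleton
  have hcpt : IsCompact (insert T {t | t ∈ Icc (0:ℝ) T ∧ balC r β x α t = 0}) :=
    (isCompact_Icc.of_isClosed_subset hcl fun t ht => ht.1).insert T
  exact hcpt.isLeast_sInf (insert_nonempty _ _)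

lemma tauC_mem_Icc {r β T x : ℝ} {α : ℝ → ℝ} (hT : 0 ≤ T)
    (hα : IntegrableOn α (Icc (0:ℝ) T)) : tauC r β T x α ∈ Icc (0:ℝ) T := by
  rcases (isLeast_tauC (r := r) (β := β) (x := x) hT hα).1 with h | h
  · rw [h]; exact ⟨hT, le_rfl⟩
  · exact h.1

/-- Before the terminal time, the discounted repayments have not exceeded the initial balance. -/
lemma discounted_repayment_le {r β T x : ℝ} {α : ℝ → ℝ} (hT : 0 ≤ T) (hx : 0 < x)
    (hα : IntegrableOn α (Icc (0:ℝ) T)) :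
    (∫ s in (0:ℝ)..(tauC r β T x α), Real.exp (-(r + β) * s) * α s) ≤ x := by
  have hleast := isLeast_tauC (r := r) (β := β) (x := x) hT hα
  have hτ := tauC_mem_Icc (r := r) (β := β) (x := x) hT hα
  have hc := (continuousOn_primitive_of_integrableOn_Icc hT
    (integrableOn_exp_mul hα (-(r + β)))).mono (Icc_subset_Icc_right hτ.2)
  by_contra! hlt
  obtain ⟨s, hs, hsx⟩ := intermediate_value_Icc hτ.1 hc ⟨by simpa using hx.le, hlt.le⟩
  have h := hleast.2 (mem_insert_of_mem T ⟨⟨hs.1, hs.2.trans hτ.2⟩, balC_eq_zero_iff.2 hsx⟩)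
  rw [← le_antisymm hs.2 h] at hlt
  exact hlt.ne' hsx

/-- A positive strategy with the same discounted repayments up to the terminal time of `α`
has the same terminal time as `α`. -/
lemma tauC_eq_of_integral_eq {r β T x : ℝ} {α γ : ℝ → ℝ} (hT : 0 ≤ T) (hx : 0 < x)
    (hα : IntegrableOn α (Icc (0:ℝ) T)) (hγ : IntegrableOn γ (Icc (0:ℝ) T))
    (hpos : ∀ t ∈ Icc (0:ℝ) T, 0 < γ t)
    (heq : (∫ s in (0:ℝ)..(tauC r β T x α), Real.exp (-(r + β) * s) * γ s)
      = ∫ s in (0:ℝ)..(tauC r β T x α), Real.exp (-(r + β) * s) * α s) :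
    tauC r β T x γ = tauC r β T x α := by
  have hleast := isLeast_tauC (r := r) (β := β) (x := x) hT hα
  have hτ := tauC_mem_Icc (r := r) (β := β) (x := x) hT hα
  have hle := discounted_repayment_le (r := r) (β := β) hT hx hα
  refine (isLeast_tauC hT hγ).unique ⟨?_, ?_⟩
  · rcases hleast.1 with h | h
    · exact Or.inl h
    · exact Or.inr ⟨h.1, balC_eq_zero_iff.2 (heq.trans (balC_eq_zero_iff.1 h.2))⟩
  · rintro t (rfl | ⟨ht, hbal⟩)
    · exact hτ.2
    by_contra! hlt
    have hw := integrableOn_exp_mul hγ (-(r + β))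
    have hgt : 0 < ∫ s in t..(tauC r β T x α), Real.exp (-(r + β) * s) * γ s :=
      intervalIntegral.intervalIntegral_pos_of_pos_on
        (intervalIntegrable_of_integrableOn_Icc hw ht hτ)
        (fun s hs => mul_pos (Real.exp_pos _)
          (hpos s ⟨ht.1.trans hs.1.le, hs.2.le.trans hτ.2⟩)) hlt
    have hadd := intervalIntegral.integral_add_adjacent_intervals
      (intervalIntegrable_of_integrableOn_Icc hw ⟨le_rfl, hT⟩ ht)
      (intervalIntegrable_of_integrableOn_Icc hw ht hτ)
    rw [balC_eq_zero_iff.1 hbal] at hadd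
    linarith

/-- Any weighted repayment of an admissible strategy up to time `τ` is matched by a max-min
strategy. -/
lemma exists_maxMin_integral_eq {T τ : ℝ} {m M α : ℝ → ℝ} (c : ℝ)
    (hmMeas : Measurable m) (hMMeas : Measurable M)
    (hm : IntegrableOn m (Icc (0:ℝ) T)) (hM : IntegrableOn M (Icc (0:ℝ) T))
    (hmM : ∀ t ∈ Icc (0:ℝ) T, m t ≤ M t) (hα : α ∈ Adm T m M) (hτ : τ ∈ Icc (0:ℝ) T) :
    ∃ t0 ∈ Icc (0:ℝ) τ, (∫ s in (0:ℝ)..τ, Real.exp (c * s) * maxMin m M t0 s)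
      = ∫ s in (0:ℝ)..τ, Real.exp (c * s) * α s := by
  have hT := hτ.1.trans hτ.2
  have h0 : (0:ℝ) ∈ Icc (0:ℝ) T := ⟨le_rfl, hT⟩
  have hwm := integrableOn_exp_mul hm c
  have hwM := integrableOn_exp_mul hM c
  have hwα := integrableOn_exp_mul (integrableOn_of_mem_Adm hm hM hα) c
  have hsplit : ∀ t0 ∈ Icc (0:ℝ) τ, (∫ s in (0:ℝ)..τ, Real.exp (c * s) * maxMin m M t0 s)
      = (∫ s in (0:ℝ)..t0, Real.exp (c * s) * M s)
        + ((∫ s in (0:ℝ)..τ, Real.exp (c * s) * m s)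
          - ∫ s in (0:ℝ)..t0, Real.exp (c * s) * m s) := by
    intro t0 ht0
    have ht0' : t0 ∈ Icc (0:ℝ) T := ⟨ht0.1, ht0.2.trans hτ.2⟩
    have hwγ := integrableOn_exp_mul
      (integrableOn_of_mem_Adm hm hM (maxMin_mem_Adm hmMeas hMMeas hmM t0)) c
    rw [intervalIntegral.integral_interval_sub_left
      (intervalIntegrable_of_integrableOn_Icc hwm h0 hτ)
      (intervalIntegrable_of_integrableOn_Icc hwm h0 ht0'),
      ← intervalIntegral.integral_add_adjacent_intervals
      (intervalIntegrable_of_integrableOn_Icc hwγ h0 ht0')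
      (intervalIntegrable_of_integrableOn_Icc hwγ ht0' hτ)]
    congr 1
    · refine intervalIntegral.integral_congr_ae (ae_of_all _ fun s hs => ?_)
      rw [uIoc_of_le ht0.1] at hs
      simp [maxMin, hs.2]
    · refine intervalIntegral.integral_congr_ae (ae_of_all _ fun s hs => ?_)
      rw [uIoc_of_le ht0.2] at hs
      simp [maxMin, hs.1.not_ge]
  have hcont : ContinuousOn (fun t0 => (∫ s in (0:ℝ)..t0, Real.exp (c * s) * M s)
        + ((∫ s in (0:ℝ)..τ, Real.exp (c * s) * m s)
          - ∫ s in (0:ℝ)..t0, Real.exp (c * s) * m s)) (Icc (0:ℝ) τ) :=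
    ((continuousOn_primitive_of_integrableOn_Icc hT hwM).add (continuousOn_const.sub
      (continuousOn_primitive_of_integrableOn_Icc hT hwm))).mono (Icc_subset_Icc_right hτ.2)
  have hlow : (∫ s in (0:ℝ)..τ, Real.exp (c * s) * m s)
      ≤ ∫ s in (0:ℝ)..τ, Real.exp (c * s) * α s :=
    intervalIntegral.integral_mono_on hτ.1 (intervalIntegrable_of_integrableOn_Icc hwm h0 hτ)
      (intervalIntegrable_of_integrableOn_Icc hwα h0 hτ) fun s hs =>
        mul_le_mul_of_nonneg_left (hα.2 s ⟨hs.1, hs.2.trans hτ.2⟩).1 (Real.exp_pos _).le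
  have hup : (∫ s in (0:ℝ)..τ, Real.exp (c * s) * α s)
      ≤ ∫ s in (0:ℝ)..τ, Real.exp (c * s) * M s :=
    intervalIntegral.integral_mono_on hτ.1 (intervalIntegrable_of_integrableOn_Icc hwα h0 hτ)
      (intervalIntegrable_of_integrableOn_Icc hwM h0 hτ) fun s hs =>
        mul_le_mul_of_nonneg_left (hα.2 s ⟨hs.1, hs.2.trans hτ.2⟩).2 (Real.exp_pos _).le
  obtain ⟨t0, ht0, h⟩ := intermediate_value_Icc hτ.1 hcont
    (show (∫ s in (0:ℝ)..τ, Real.exp (c * s) * α s) ∈ Icc _ _ from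
      ⟨by simpa using hlow, by simpa using hup⟩)
  exact ⟨t0, ht0, (hsplit t0 ht0).trans h⟩

/-- Among strategies with equal repayments discounted at rate `r + β`, the max-min strategy
minimizes the repayments discounted at rate `r`. -/
lemma integral_maxMin_le {r β T τ t0 : ℝ} {m M α : ℝ → ℝ} (hβ : 0 ≤ β)
    (hmMeas : Measurable m) (hMMeas : Measurable M)
    (hm : IntegrableOn m (Icc (0:ℝ) T)) (hM : IntegrableOn M (Icc (0:ℝ) T))
    (hmM : ∀ t ∈ Icc (0:ℝ) T, m t ≤ M t) (hα : α ∈ Adm T m M) (hτ : τ ∈ Icc (0:ℝ) T)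
    (heq : (∫ s in (0:ℝ)..τ, Real.exp (-(r + β) * s) * maxMin m M t0 s)
      = ∫ s in (0:ℝ)..τ, Real.exp (-(r + β) * s) * α s) :
    (∫ s in (0:ℝ)..τ, Real.exp (-r * s) * maxMin m M t0 s)
      ≤ ∫ s in (0:ℝ)..τ, Real.exp (-r * s) * α s := by
  have h0 : (0:ℝ) ∈ Icc (0:ℝ) T := ⟨le_rfl, hτ.1.trans hτ.2⟩
  have hI : ∀ γ ∈ Adm T m M, ∀ c : ℝ,
      IntervalIntegrable (fun s => Real.exp (c * s) * γ s) volume 0 τ := fun γ hγ c =>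
    intervalIntegrable_of_integrableOn_Icc
      (integrableOn_exp_mul (integrableOn_of_mem_Adm hm hM hγ) c) h0 hτ
  have hγ := maxMin_mem_Adm hmMeas hMMeas hmM t0
  have hmono := intervalIntegral.integral_mono_on hτ.1
    ((hI _ hγ (-r)).sub ((hI _ hγ (-(r + β))).const_mul (Real.exp (β * t0))))
    ((hI _ hα (-r)).sub ((hI _ hα (-(r + β))).const_mul (Real.exp (β * t0))))
    (fun s hs => by
      have hb := hα.2 s ⟨hs.1, hs.2.trans hτ.2⟩
      have he : Real.exp (-r * s) = Real.exp (β * s) * Real.exp (-(r + β) * s) := by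
        rw [← Real.exp_add]; ring_nf
      have hw := Real.exp_pos (-(r + β) * s)
      have key : (Real.exp (β * s) - Real.exp (β * t0)) * (maxMin m M t0 s - α s) ≤ 0 := by
        unfold maxMin
        split_ifs with h
        · exact mul_nonpos_of_nonpos_of_nonneg (sub_nonpos.2 (Real.exp_le_exp.2
            (mul_le_mul_of_nonneg_left h hβ))) (sub_nonneg.2 hb.2)
        · exact mul_nonpos_of_nonneg_of_nonpos (sub_nonneg.2 (Real.exp_le_exp.2
            (mul_le_mul_of_nonneg_left (not_le.1 h).le hβ))) (sub_nonpos.2 hb.1)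
      simp only [he]
      nlinarith [mul_nonpos_of_nonneg_of_nonpos hw.le key])
  rw [intervalIntegral.integral_sub (hI _ hγ _) ((hI _ hγ _).const_mul _),
    intervalIntegral.integral_sub (hI _ hα _) ((hI _ hα _).const_mul _),
    intervalIntegral.integral_const_mul, intervalIntegral.integral_const_mul, heq] at hmono
  linarith

/-- the infimum over all admissible strategies equals the infimum
over max-min strategies `ℬ`. -/
theorem stmt3 (r β T ω : ℝ) (m M : ℝ → ℝ)
    (hr : 0 < r) (hβ : 0 < β) (hT : 0 < T) (hω : ω ∈ Ioo (0:ℝ) 1)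
    (hmMeas : Measurable m) (hMMeas : Measurable M)
    (hmInt : IntegrableOn m (Icc (0:ℝ) T)) (hMInt : IntegrableOn M (Icc (0:ℝ) T))
    (hmM : ∀ t ∈ Icc (0:ℝ) T, 0 < m t ∧ m t < M t)
    (x : ℝ) (hx : 0 < x) :
    valC r β T ω m M x
      = sInf (costC r β T ω x ''
          {α ∈ Adm T m M | ∃ t0 : ℝ, 0 ≤ t0 ∧
            ∀ᵐ t ∂(volume.restrict (Icc (0:ℝ) T)),
              α t = if t ≤ t0 then M t else m t}) := by
  have hmM' : ∀ t ∈ Icc (0:ℝ) T, m t ≤ M t := fun t ht => (hmM t ht).2.le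
  refine csInf_eq_csInf_of_forall_exists_le ?_ ?_
  · rintro _ ⟨α, hα, rfl⟩
    have hαI := integrableOn_of_mem_Adm hmInt hMInt hα
    have hτ := tauC_mem_Icc (r := r) (β := β) (x := x) hT.le hαI
    obtain ⟨t0, ht0, heq⟩ := exists_maxMin_integral_eq (-(r + β)) hmMeas hMMeas hmInt hMInt
      hmM' hα hτ
    have hγ := maxMin_mem_Adm hmMeas hMMeas hmM' t0
    refine ⟨_, ⟨maxMin m M t0, ⟨hγ, t0, ht0.1, ae_of_all _ fun _ => rfl⟩, rfl⟩, ?_⟩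
    have hτeq := tauC_eq_of_integral_eq hT.le hx hαI
      (integrableOn_of_mem_Adm hmInt hMInt hγ)
      (fun t ht => (hmM t ht).1.trans_le (hγ.2 t ht).1) heq
    have hcost := integral_maxMin_le hβ.le hmMeas hMMeas hmInt hMInt hmM' hα hτ heq
    simp only [costC, balC, hτeq, heq]
    linarith
  · rintro _ ⟨α, hα, rfl⟩
    exact ⟨_, ⟨α, hα.1, rfl⟩, le_rfl⟩
end
end

section
/- If 0 < x ≤ x̲ := ∫_0^T e^{−(r+β)s} m(s) ds, then there exists a unique t_M ∈ (0,T] such that x = ∫_0^{t_M} e^{−(r+β)s} M(s) ds; the strategy α*(t) := M(t) for all t ∈ [0,T] attains the infimum defining v(x); moreover τ(α*) = t_M < T and v(x) = ∫_0^{t_M} e^{−rs} M(s) ds. -/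
open MeasureTheory Set

noncomputable section

/-- Multiplying by an exponential preserves integrability on subintervals of `[0,T]`. -/
theorem intervalIntegrable_exp_mul {T : ℝ} {α : ℝ → ℝ} (hα : IntegrableOn α (Icc 0 T)) (c : ℝ)
    {a b : ℝ} (ha : a ∈ Icc 0 T) (hb : b ∈ Icc 0 T) :
    IntervalIntegrable (fun s => Real.exp (c * s) * α s) volume a b := by
  have h : IntervalIntegrable α volume a b :=
    (hα.mono_set (uIcc_subset_Icc ha hb)).intervalIntegrable
  exact h.continuousOn_mul (by fun_prop)

theorem Adm.integrableOn {T : ℝ} {m M α : ℝ → ℝ} (hMInt : IntegrableOn M (Icc 0 T))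
    (hm : ∀ t ∈ Icc 0 T, 0 < m t) (hα : α ∈ Adm T m M) : IntegrableOn α (Icc 0 T) := by
  refine Integrable.mono' hMInt hα.1.aestronglyMeasurable ?_
  filter_upwards [ae_restrict_mem measurableSet_Icc] with t ht
  have h := hα.2 t ht
  rw [Real.norm_of_nonneg ((hm t ht).le.trans h.1)]
  exact h.2

/-- The discounted accumulated repayment of a positive strategy is strictly increasing. -/
theorem strictMonoOn_integral_exp_mul {T : ℝ} {α : ℝ → ℝ} (hα : IntegrableOn α (Icc 0 T))
    (hpos : ∀ t ∈ Icc 0 T, 0 < α t) (c : ℝ) :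
    StrictMonoOn (fun t => ∫ s in (0:ℝ)..t, Real.exp (c * s) * α s) (Icc 0 T) := by
  intro a ha b hb hab
  have h0 : (0:ℝ) ∈ Icc 0 T := ⟨le_rfl, ha.1.trans ha.2⟩
  have hp : 0 < ∫ s in a..b, Real.exp (c * s) * α s := by
    refine intervalIntegral.intervalIntegral_pos_of_pos_on
      (intervalIntegrable_exp_mul hα c ha hb) (fun s hs => ?_) hab
    have := hpos s ⟨ha.1.trans hs.1.le, hs.2.le.trans hb.2⟩
    positivity
  have := intervalIntegral.integral_add_adjacent_intervals
    (intervalIntegrable_exp_mul hα c h0 ha) (intervalIntegrable_exp_mul hα c ha hb)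
  dsimp only
  linarith

/-- A repayment total between `0` and the full discounted repayment is reached on `[0,T]`. -/
theorem exists_integral_exp_mul_eq {T : ℝ} {α : ℝ → ℝ} (hT : 0 ≤ T)
    (hα : IntegrableOn α (Icc 0 T)) (c : ℝ) {x : ℝ} (hx0 : 0 < x)
    (hx : x ≤ ∫ s in (0:ℝ)..T, Real.exp (c * s) * α s) :
    ∃ t ∈ Ioc 0 T, ∫ s in (0:ℝ)..t, Real.exp (c * s) * α s = x := by
  have hcont : ContinuousOn (fun t => ∫ s in (0:ℝ)..t, Real.exp (c * s) * α s) (Icc 0 T) := by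
    rw [← uIcc_of_le hT]
    refine intervalIntegral.continuousOn_primitive_interval ?_
    rw [uIcc_of_le hT]
    exact hα.continuousOn_mul (by fun_prop) isCompact_Icc
  obtain ⟨t, ht, hxt⟩ := intermediate_value_Icc hT hcont
    (show x ∈ Icc _ _ from ⟨by simpa using hx0.le, hx⟩)
  refine ⟨t, ⟨ht.1.lt_of_ne ?_, ht.2⟩, hxt⟩
  rintro rfl
  simp only [intervalIntegral.integral_same] at hxt
  exact hx0.ne hxt

theorem tauC_eq {r β T x : ℝ} {α : ℝ → ℝ} (hα : IntegrableOn α (Icc 0 T))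
    (hpos : ∀ t ∈ Icc 0 T, 0 < α t) {t : ℝ} (ht : t ∈ Icc 0 T)
    (hxt : ∫ s in (0:ℝ)..t, Real.exp (-(r + β) * s) * α s = x) : tauC r β T x α = t := by
  have hset : {u | u ∈ Icc (0:ℝ) T ∧ balC r β x α u = 0} = {t} := by
    ext u
    simp only [mem_ofPred_eq, mem_singleton_iff, balC]
    constructor
    · rintro ⟨hu, h⟩
      have h' := (mul_eq_zero.mp h).resolve_left (Real.exp_pos _).ne'
      refine (strictMonoOn_integral_exp_mul hα hpos (-(r + β))).injOn hu ht ?_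
      linarith
    · rintro rfl
      exact ⟨ht, by rw [hxt, sub_self, mul_zero]⟩
  rw [tauC, hset, csInf_pair]
  exact inf_eq_right.mpr ht.2

theorem costC_eq {r β T ω x : ℝ} {α : ℝ → ℝ} (hα : IntegrableOn α (Icc 0 T))
    (hpos : ∀ t ∈ Icc 0 T, 0 < α t) {t : ℝ} (ht : t ∈ Icc 0 T)
    (hxt : ∫ s in (0:ℝ)..t, Real.exp (-(r + β) * s) * α s = x) :
    costC r β T ω x α = ∫ s in (0:ℝ)..t, Real.exp (-r * s) * α s := by
  rw [costC, tauC_eq hα hpos ht hxt, balC, hxt, sub_self, mul_zero, mul_zero, add_zero]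

/-- Paying faster from the start is cheaper: among strategies repaying the same compounded
total, the pointwise larger one has the smaller discounted cost. -/
theorem integral_exp_mul_le_of_le {T r β : ℝ} {α M : ℝ → ℝ} (hβ : 0 ≤ β)
    (hα : IntegrableOn α (Icc 0 T)) (hM : IntegrableOn M (Icc 0 T))
    (hpos : ∀ t ∈ Icc 0 T, 0 ≤ α t) (hle : ∀ t ∈ Icc 0 T, α t ≤ M t)
    {a b : ℝ} (ha : a ∈ Icc 0 T) (hb : b ∈ Icc 0 T) (hab : a ≤ b)
    (heq : ∫ s in (0:ℝ)..a, Real.exp (-(r + β) * s) * M s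
      = ∫ s in (0:ℝ)..b, Real.exp (-(r + β) * s) * α s) :
    ∫ s in (0:ℝ)..a, Real.exp (-r * s) * M s ≤ ∫ s in (0:ℝ)..b, Real.exp (-r * s) * α s := by
  have h0 : (0:ℝ) ∈ Icc 0 T := ⟨le_rfl, ha.1.trans ha.2⟩
  have hexp (s : ℝ) : Real.exp (-r * s) = Real.exp (β * s) * Real.exp (-(r + β) * s) := by
    rw [← Real.exp_add]; ring_nf
  have key₁ : Real.exp (β * a) * (∫ s in a..b, Real.exp (-(r + β) * s) * α s)
      ≤ ∫ s in a..b, Real.exp (-r * s) * α s := by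
    rw [← intervalIntegral.integral_const_mul]
    refine intervalIntegral.integral_mono_on hab
      ((intervalIntegrable_exp_mul hα _ ha hb).const_mul _)
      (intervalIntegrable_exp_mul hα _ ha hb) (fun s hs => ?_)
    have hs0 := hpos s ⟨ha.1.trans hs.1, hs.2.trans hb.2⟩
    have hs1 := hs.1
    rw [hexp, mul_assoc]
    gcongr
  have key₂ : (∫ s in (0:ℝ)..a, Real.exp (-r * s) * M s)
        - ∫ s in (0:ℝ)..a, Real.exp (-r * s) * α s
      ≤ Real.exp (β * a) * ((∫ s in (0:ℝ)..a, Real.exp (-(r + β) * s) * M s)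
        - ∫ s in (0:ℝ)..a, Real.exp (-(r + β) * s) * α s) := by
    have iM (c : ℝ) := intervalIntegrable_exp_mul hM c h0 ha
    have iα (c : ℝ) := intervalIntegrable_exp_mul hα c h0 ha
    rw [← intervalIntegral.integral_sub (iM _) (iα _),
      ← intervalIntegral.integral_sub (iM _) (iα _), ← intervalIntegral.integral_const_mul]
    refine intervalIntegral.integral_mono_on ha.1 ((iM _).sub (iα _))
      (((iM _).sub (iα _)).const_mul _) (fun s hs => ?_)
    have hs0 := sub_nonneg.mpr (hle s ⟨hs.1, hs.2.trans ha.2⟩)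
    have hs1 := hs.2
    rw [← mul_sub, ← mul_sub, hexp, mul_assoc]
    gcongr
  have split (c : ℝ) := intervalIntegral.integral_add_adjacent_intervals
    (intervalIntegrable_exp_mul hα c h0 ha) (intervalIntegrable_exp_mul hα c ha hb)
  rw [heq, ← split (-(r + β)), add_sub_cancel_left] at key₂
  rw [← split (-r)]
  linarith

/-- for `0 < x ≤ x̲`, there is a unique `t_M ∈ (0,T]` with
`x = ∫_0^{t_M} e^{-(r+β)s} M(s) ds`; the max strategy attains the infimum,
`τ(α*) = t_M < T`, and `v(x) = ∫_0^{t_M} e^{-rs} M(s) ds`. -/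
theorem stmt5 (r β T ω : ℝ) (m M : ℝ → ℝ)
    (hr : 0 < r) (hβ : 0 < β) (hT : 0 < T) (hω : ω ∈ Ioo (0:ℝ) 1)
    (hmMeas : Measurable m) (hMMeas : Measurable M)
    (hmInt : IntegrableOn m (Icc (0:ℝ) T)) (hMInt : IntegrableOn M (Icc (0:ℝ) T))
    (hmM : ∀ t ∈ Icc (0:ℝ) T, 0 < m t ∧ m t < M t)
    (x : ℝ) (hx0 : 0 < x) (hx : x ≤ xLow r β T m) :
    ∃ tM : ℝ, tM ∈ Ioc (0:ℝ) T ∧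
      x = (∫ s in (0:ℝ)..tM, Real.exp (-(r + β) * s) * M s) ∧
      (∀ t' ∈ Ioc (0:ℝ) T,
        x = (∫ s in (0:ℝ)..t', Real.exp (-(r + β) * s) * M s) → t' = tM) ∧
      M ∈ Adm T m M ∧
      costC r β T ω x M = valC r β T ω m M x ∧
      tauC r β T x M = tM ∧ tM < T ∧
      valC r β T ω m M x = ∫ s in (0:ℝ)..tM, Real.exp (-r * s) * M s := by
  have h0T : (0:ℝ) ∈ Icc 0 T := ⟨le_rfl, hT.le⟩
  have hTT : T ∈ Icc (0:ℝ) T := ⟨hT.le, le_rfl⟩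
  have hmpos : ∀ t ∈ Icc (0:ℝ) T, 0 < m t := fun t ht => (hmM t ht).1
  have hMpos : ∀ t ∈ Icc (0:ℝ) T, 0 < M t := fun t ht => (hmpos t ht).trans (hmM t ht).2
  have hMAdm : M ∈ Adm T m M := ⟨hMMeas, fun t ht => ⟨(hmM t ht).2.le, le_rfl⟩⟩
  have hxM : x < ∫ s in (0:ℝ)..T, Real.exp (-(r + β) * s) * M s := by
    have hlt : 0 < ∫ s in (0:ℝ)..T,
        (Real.exp (-(r + β) * s) * M s - Real.exp (-(r + β) * s) * m s) := by
      refine intervalIntegral.intervalIntegral_pos_of_pos_on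
        ((intervalIntegrable_exp_mul hMInt _ h0T hTT).sub
          (intervalIntegrable_exp_mul hmInt _ h0T hTT)) (fun s hs => ?_) hT
      have := sub_pos.mpr (hmM s ⟨hs.1.le, hs.2.le⟩).2
      rw [← mul_sub]
      positivity
    rw [intervalIntegral.integral_sub (intervalIntegrable_exp_mul hMInt _ h0T hTT)
      (intervalIntegrable_exp_mul hmInt _ h0T hTT)] at hlt
    rw [xLow] at hx
    linarith
  obtain ⟨tM, htM, hxtM⟩ := exists_integral_exp_mul_eq hT.le hMInt _ hx0 hxM.le
  have htM' : tM ∈ Icc 0 T := Ioc_subset_Icc_self htM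
  have hcostM := costC_eq (ω := ω) hMInt hMpos htM' hxtM
  have hmin : IsLeast (costC r β T ω x '' Adm T m M) (costC r β T ω x M) := by
    refine ⟨mem_image_of_mem _ hMAdm, ?_⟩
    rintro _ ⟨α, hα, rfl⟩
    have hαInt := Adm.integrableOn hMInt hmpos hα
    have hαpos : ∀ t ∈ Icc 0 T, 0 < α t := fun t ht => (hmpos t ht).trans_le (hα.2 t ht).1
    have hxα : x ≤ ∫ s in (0:ℝ)..T, Real.exp (-(r + β) * s) * α s := by
      refine hx.trans (intervalIntegral.integral_mono_on hT.le
        (intervalIntegrable_exp_mul hmInt _ h0T hTT)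
        (intervalIntegrable_exp_mul hαInt _ h0T hTT) (fun s hs => ?_))
      have := (hα.2 s hs).1
      gcongr
    obtain ⟨t, ht, hxt⟩ := exists_integral_exp_mul_eq hT.le hαInt _ hx0 hxα
    have ht' : t ∈ Icc 0 T := Ioc_subset_Icc_self ht
    have htMt : tM ≤ t := by
      refine ((strictMonoOn_integral_exp_mul hMInt hMpos (-(r + β))).le_iff_le htM' ht').mp ?_
      refine (hxtM.trans hxt.symm).trans_le (intervalIntegral.integral_mono_on ht.1.le
        (intervalIntegrable_exp_mul hαInt _ h0T ht')
        (intervalIntegrable_exp_mul hMInt _ h0T ht') (fun s hs => ?_))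
      have := (hα.2 s ⟨hs.1, hs.2.trans ht.2⟩).2
      gcongr
    rw [hcostM, costC_eq hαInt hαpos ht' hxt]
    exact integral_exp_mul_le_of_le hβ.le hαInt hMInt (fun s hs => (hαpos s hs).le)
      (fun s hs => (hα.2 s hs).2) htM' ht' htMt (hxtM.trans hxt.symm)
  have hval : valC r β T ω m M x = costC r β T ω x M := hmin.csInf_eq
  refine ⟨tM, htM, hxtM.symm, fun t' ht' h => ?_, hMAdm, hval.symm,
    tauC_eq hMInt hMpos htM' hxtM, htM.2.lt_of_ne ?_, hval.trans hcostM⟩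
  · exact (strictMonoOn_integral_exp_mul hMInt hMpos (-(r + β))).injOn
      (Ioc_subset_Icc_self ht') htM' (h.symm.trans hxtM.symm)
  · rintro rfl
    exact hxM.ne hxtM.symm
end
end
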